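/- arXiv:2010.05065 — 2 statements merged into one kernel-verified Lean document; each statement's English description precedes it below -/
import Mathlib

section
/- Let G be a d-regular graph on n vertices whose second largest absolute adjacency eigenvalue is at most λ. If X and Y are disjoint subsets of V(G) with no edges of G between X and Y (e(X,Y) = 0), then d²·|X|·|Y| ≤ λ²·(n − |X|)·(n − |Y|)·[formally: |X||Y| ≤ (λ²/d²)(n − |X|)(n − |Y|), assuming d > 0]. -/
open Finset

/-- The adjacency matrix of a simple graph over `ℝ` is Hermitian. -/
theorem adjMatrix_isHermitian {V : Type*} [Fintype V] (G : SimpleGraph V)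
    [DecidableRel G.Adj] : (G.adjMatrix ℝ).IsHermitian := by
  unfold Matrix.IsHermitian
  rw [Matrix.conjTranspose_eq_transpose_of_trivial]
  exact G.isSymm_adjMatrix

/-- The second largest absolute eigenvalue of the adjacency matrix of `G`:
if the eigenvalues are `λ₁ ≥ λ₂ ≥ ... ≥ λₙ`, this is `max_{2 ≤ i ≤ n} |λᵢ|`
(interpreted as `0` when `n ≤ 1`). -/
noncomputable def sndAbsEig {V : Type*} [Fintype V] [DecidableEq V] (G : SimpleGraph V)
    [DecidableRel G.Adj] : ℝ :=
  (((((Multiset.map (adjMatrix_isHermitian G).eigenvalues Finset.univ.val).sort (· ≤ ·)).dropLast).map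
    (fun x => |x|)).foldr max 0)

/-- `eAB G A B` is the number of edges of `G` with one end in `A` and the other end in `B`,
where edges with both ends in `A ∩ B` are counted twice. -/
def eAB {V : Type*} (G : SimpleGraph V) [DecidableRel G.Adj] (A B : Finset V) : ℕ :=
  ∑ a ∈ A, ∑ b ∈ B, if G.Adj a b then 1 else 0

/-- `eIn G A` is the number of edges of `G` with both ends in `A`. -/
noncomputable def eIn {V : Type*} [Fintype V] [DecidableEq V] (G : SimpleGraph V)
    [DecidableRel G.Adj] (A : Finset V) : ℕ :=
  letI := Classical.dec
  (G.edgeFinset.filter (fun e => ∀ v ∈ e, v ∈ A)).card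

/-- The number of connected components of the graph obtained from `G`
by deleting the vertices of `S`. -/
noncomputable def numComp {V : Type*} [Fintype V] [DecidableEq V] (G : SimpleGraph V)
    (S : Finset V) : ℕ :=
  Nat.card (G.induce ((Sᶜ : Finset V) : Set V)).ConnectedComponent

/-- Removing the last entry of a sorted list of values of `f` discards the value at one index only. -/
theorem exists_forall_ne_mem_dropLast_sort {ι : Type*} [Fintype ι] [DecidableEq ι] [Nonempty ι]
    (f : ι → ℝ) :
    ∃ i₀, ∀ i, i ≠ i₀ →
      f i ∈ ((Multiset.map f Finset.univ.val).sort (· ≤ ·)).dropLast := by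
  set l := (Multiset.map f Finset.univ.val).sort (· ≤ ·)
  have hcoe : (l : Multiset ℝ) = Multiset.map f Finset.univ.val := Multiset.sort_eq _ _
  have hne : l ≠ [] := by
    intro h
    have hcard := congrArg Multiset.card hcoe
    rw [h] at hcard
    simp at hcard
    exact Fintype.card_ne_zero hcard.symm
  have hlast : l.getLast hne ∈ Multiset.map f Finset.univ.val := by
    rw [← hcoe]
    exact Multiset.mem_coe.2 (List.getLast_mem hne)
  obtain ⟨i₀, -, hi₀⟩ := Multiset.mem_map.1 hlast
  refine ⟨i₀, fun i hi => ?_⟩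
  have hsplit : f i₀ ::ₘ (l.dropLast : Multiset ℝ) =
      f i₀ ::ₘ Multiset.map f (Finset.univ.val.erase i₀) := by
    rw [← Multiset.map_cons, Multiset.cons_erase (Finset.mem_univ_val i₀), ← hcoe, hi₀,
      Multiset.cons_coe, Multiset.coe_eq_coe]
    conv_rhs => rw [← List.dropLast_append_getLast hne]
    exact (List.perm_append_singleton _ _).symm
  rw [← Multiset.mem_coe, (Multiset.cons_inj_right _).1 hsplit]
  exact Multiset.mem_map_of_mem f ((Multiset.mem_erase_of_ne hi).2 (Finset.mem_univ_val i))

theorem abs_le_foldr_max {l : List ℝ} {x : ℝ} (hx : x ∈ l) :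
    |x| ≤ (l.map (fun x => |x|)).foldr max 0 := by
  induction l with
  | nil => simp at hx
  | cons a l ih =>
    rcases List.mem_cons.1 hx with rfl | h
    · exact le_max_left _ _
    · exact (ih h).trans (le_max_right _ _)

/-- All eigenvalues but one are bounded in absolute value by `sndAbsEig`. -/
theorem exists_forall_ne_abs_eigenvalues_le_sndAbsEig {V : Type*} [Fintype V] [DecidableEq V]
    [Nonempty V] (G : SimpleGraph V) [DecidableRel G.Adj] :
    ∃ i₀, ∀ i, i ≠ i₀ → |(adjMatrix_isHermitian G).eigenvalues i| ≤ sndAbsEig G := by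
  obtain ⟨i₀, h⟩ := exists_forall_ne_mem_dropLast_sort (adjMatrix_isHermitian G).eigenvalues
  exact ⟨i₀, fun i hi => abs_le_foldr_max (h i hi)⟩

theorem abs_eigenvalues_adjMatrix_le {V : Type*} [Fintype V] [DecidableEq V]
    (G : SimpleGraph V) [DecidableRel G.Adj] {d : ℕ} (hreg : G.IsRegularOfDegree d) (i : V) :
    |(adjMatrix_isHermitian G).eigenvalues i| ≤ d := by
  have hev : Module.End.HasEigenvalue (Matrix.toLin' (G.adjMatrix ℝ))
      ((adjMatrix_isHermitian G).eigenvalues i) := by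
    refine Module.End.hasEigenvalue_of_hasEigenvector
      (x := ⇑((adjMatrix_isHermitian G).eigenvectorBasis i)) ⟨?_, ?_⟩
    · rw [Module.End.mem_eigenspace_iff, Matrix.toLin'_apply]
      exact (adjMatrix_isHermitian G).mulVec_eigenvectorBasis i
    · intro h
      apply (adjMatrix_isHermitian G).eigenvectorBasis.orthonormal.ne_zero i
      ext v
      exact congrFun h v
  obtain ⟨k, hk⟩ := eigenvalue_mem_ball hev
  have hsum : ∑ j ∈ Finset.univ.erase k, ‖G.adjMatrix ℝ k j‖ = d := by
    rw [Finset.sum_erase _ (by simp)]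
    have hk := hreg k
    rw [← hk, ← SimpleGraph.card_neighborFinset_eq_degree, SimpleGraph.neighborFinset_eq_filter,
      Finset.card_filter]
    push_cast
    refine Finset.sum_congr rfl fun j _ => ?_
    rw [SimpleGraph.adjMatrix_apply]
    split_ifs <;> simp
  rw [hsum, mem_closedBall_iff_norm] at hk
  simpa using hk

/-- On vectors with coordinate sum zero, the adjacency matrix of a regular graph has norm at most
`sndAbsEig`. -/
theorem norm_adjMatrix_mulVec_sq_le {V : Type*} [Fintype V] [DecidableEq V] [Nonempty V]
    (G : SimpleGraph V) [DecidableRel G.Adj] {d : ℕ} (hreg : G.IsRegularOfDegree d)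
    (x : V → ℝ) (hx : ∑ v, x v = 0) :
    ∑ v, (G.adjMatrix ℝ).mulVec x v ^ 2 ≤ sndAbsEig G ^ 2 * ∑ v, x v ^ 2 := by
  set A := G.adjMatrix ℝ with hA
  set b := (adjMatrix_isHermitian G).eigenvectorBasis
  set ev := (adjMatrix_isHermitian G).eigenvalues
  obtain ⟨i₀, hi₀⟩ := exists_forall_ne_abs_eigenvalues_le_sndAbsEig G
  have parseval (y : V → ℝ) : ∑ v, y v ^ 2 = ∑ i, (⇑(b i) ⬝ᵥ y) ^ 2 := by
    have h := b.sum_sq_norm_inner_right (WithLp.toLp 2 y)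
    rw [EuclideanSpace.norm_sq_eq] at h
    simpa [PiLp.inner_apply, dotProduct, mul_comm] using h.symm
  have hinner (i : V) (y : V → ℝ) : ⇑(b i) ⬝ᵥ A.mulVec y = ev i * (⇑(b i) ⬝ᵥ y) := by
    have hmul : A.mulVec ⇑(b i) = ev i • ⇑(b i) :=
      (adjMatrix_isHermitian G).mulVec_eigenvectorBasis i
    rw [Matrix.dotProduct_mulVec, ← Matrix.mulVec_transpose, hA, SimpleGraph.transpose_adjMatrix,
      ← hA, hmul, smul_dotProduct, smul_eq_mul]
  have hone : A.mulVec (fun _ => 1) = (d : ℝ) • fun _ => (1 : ℝ) := by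
    ext v
    have hv := hreg v
    simp [hA, SimpleGraph.adjMatrix_mulVec_apply, hv]
  have hone_ortho (i : V) (hi : ev i ≠ d) : ⇑(b i) ⬝ᵥ (fun _ => (1 : ℝ)) = 0 := by
    have h := hinner i (fun _ => 1)
    rw [hone, dotProduct_smul, smul_eq_mul] at h
    exact (mul_eq_zero.1 (show (ev i - d) * (⇑(b i) ⬝ᵥ (fun _ => (1 : ℝ))) = 0 by
      linarith)).resolve_left (sub_ne_zero.2 hi)
  rw [parseval (A.mulVec x), parseval x, Finset.mul_sum]
  refine Finset.sum_le_sum fun i _ => ?_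
  rw [hinner, mul_pow]
  have bound (h : |ev i| ≤ sndAbsEig G) :
      ev i ^ 2 * (⇑(b i) ⬝ᵥ x) ^ 2 ≤ sndAbsEig G ^ 2 * (⇑(b i) ⬝ᵥ x) ^ 2 :=
    mul_le_mul_of_nonneg_right (sq_le_sq.2 (h.trans (le_abs_self _))) (sq_nonneg _)
  by_cases hii : i = i₀
  swap
  · exact bound (hi₀ i hii)
  by_cases hd : (d : ℝ) ≤ sndAbsEig G
  · exact bound ((abs_eigenvalues_adjMatrix_le G hreg i).trans hd)
  have hother (j : V) (hj : j ≠ i) : ⇑(b j) ⬝ᵥ (fun _ => (1 : ℝ)) = 0 := by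
    refine hone_ortho j fun h => hd ?_
    rw [← h]
    exact (le_abs_self _).trans (hi₀ j (hii ▸ hj))
  have hexp : WithLp.toLp 2 (fun _ : V => (1 : ℝ)) =
      (⇑(b i) ⬝ᵥ (fun _ => (1 : ℝ))) • b i := by
    have hcoef (j : V) : inner ℝ (b j) (WithLp.toLp 2 (fun _ : V => (1 : ℝ))) =
        ⇑(b j) ⬝ᵥ (fun _ => (1 : ℝ)) := by
      simp [PiLp.inner_apply, dotProduct]
    rw [← b.sum_repr' (WithLp.toLp 2 (fun _ : V => (1 : ℝ))),
      Finset.sum_eq_single i (fun j _ hj => by rw [hcoef, hother j hj, zero_smul]) (by simp), hcoef]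
  have hcoord (v : V) : 1 = (⇑(b i) ⬝ᵥ (fun _ => (1 : ℝ))) * b i v := by
    simpa using congrArg (fun z : EuclideanSpace ℝ V => z v) hexp
  have hmul : (⇑(b i) ⬝ᵥ (fun _ => (1 : ℝ))) * (⇑(b i) ⬝ᵥ x) = 0 := by
    rw [← hx]
    rw [show ⇑(b i) ⬝ᵥ x = ∑ v, b i v * x v from rfl, Finset.mul_sum]
    refine Finset.sum_congr rfl fun v _ => ?_
    rw [← mul_assoc, ← hcoord, one_mul]
  have hzero : ⇑(b i) ⬝ᵥ x = 0 := by
    refine (mul_eq_zero.1 hmul).resolve_left fun h => ?_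
    have hv := hcoord i
    rw [h, zero_mul] at hv
    exact one_ne_zero hv
  rw [hzero]
  simp

/-- The indicator vector of `X`, projected orthogonally to the all-ones vector. -/
noncomputable def centeredIndicator {V : Type*} [Fintype V] [DecidableEq V] (X : Finset V) :
    V → ℝ :=
  fun v => (if v ∈ X then 1 else 0) - (X.card : ℝ) / Fintype.card V

theorem sum_centeredIndicator {V : Type*} [Fintype V] [DecidableEq V] [Nonempty V]
    (X : Finset V) : ∑ v, centeredIndicator X v = 0 := by
  have hn : (Fintype.card V : ℝ) ≠ 0 := Nat.cast_ne_zero.2 Fintype.card_ne_zero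
  simp only [centeredIndicator, Finset.sum_sub_distrib, Finset.sum_ite_mem, Finset.univ_inter,
    Finset.sum_const, Finset.card_univ, nsmul_eq_mul]
  field_simp
  ring

theorem sum_centeredIndicator_sq {V : Type*} [Fintype V] [DecidableEq V] [Nonempty V]
    (X : Finset V) :
    ∑ v, centeredIndicator X v ^ 2 =
      X.card * (Fintype.card V - X.card) / (Fintype.card V : ℝ) := by
  have hn : (Fintype.card V : ℝ) ≠ 0 := Nat.cast_ne_zero.2 Fintype.card_ne_zero
  have h (v : V) : centeredIndicator X v ^ 2 =
      (if v ∈ X then 1 - 2 * ((X.card : ℝ) / Fintype.card V) else 0) +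
        ((X.card : ℝ) / Fintype.card V) ^ 2 := by
    unfold centeredIndicator
    split_ifs <;> ring
  simp only [h, Finset.sum_add_distrib, Finset.sum_ite_mem, Finset.univ_inter,
    Finset.sum_const, Finset.card_univ, nsmul_eq_mul]
  field_simp
  ring

theorem centeredIndicator_dotProduct_adjMatrix_mulVec {V : Type*} [Fintype V] [DecidableEq V]
    [Nonempty V] (G : SimpleGraph V) [DecidableRel G.Adj] {d : ℕ}
    (hreg : G.IsRegularOfDegree d) (X Y : Finset V) :
    ∑ v, centeredIndicator X v * (G.adjMatrix ℝ).mulVec (centeredIndicator Y) v =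
      eAB G X Y - d * X.card * Y.card / (Fintype.card V : ℝ) := by
  have hmul (v : V) : (G.adjMatrix ℝ).mulVec (centeredIndicator Y) v =
      (∑ w ∈ Y, if G.Adj v w then (1 : ℝ) else 0) - d * (Y.card / (Fintype.card V : ℝ)) := by
    have hv := hreg v
    rw [SimpleGraph.adjMatrix_mulVec_apply]
    simp only [centeredIndicator, Finset.sum_sub_distrib, Finset.sum_const, nsmul_eq_mul,
      SimpleGraph.card_neighborFinset_eq_degree, hv]
    congr 1
    rw [← Finset.sum_filter, ← Finset.sum_filter, Finset.sum_const, Finset.sum_const]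
    congr 2
    ext w
    simp [and_comm]
  have hcol (w : V) : (∑ v, if G.Adj v w then (1 : ℝ) else 0) = d := by
    have hw := hreg w
    rw [← hw, ← SimpleGraph.card_neighborFinset_eq_degree, SimpleGraph.neighborFinset_eq_filter,
      Finset.card_filter]
    simp [G.adj_comm]
  have hrows : ∑ v, (G.adjMatrix ℝ).mulVec (centeredIndicator Y) v = 0 := by
    have hn : (Fintype.card V : ℝ) ≠ 0 := Nat.cast_ne_zero.2 Fintype.card_ne_zero
    simp only [hmul, Finset.sum_sub_distrib]
    rw [Finset.sum_comm]
    simp only [hcol, Finset.sum_const, Finset.card_univ, nsmul_eq_mul]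
    field_simp
    ring
  calc ∑ v, centeredIndicator X v * (G.adjMatrix ℝ).mulVec (centeredIndicator Y) v
      = ∑ v ∈ X, (G.adjMatrix ℝ).mulVec (centeredIndicator Y) v := by
        conv_lhs => simp only [centeredIndicator.eq_def X, sub_mul, Finset.sum_sub_distrib]
        rw [← Finset.mul_sum, hrows]
        simp
    _ = _ := by
        simp only [hmul, Finset.sum_sub_distrib, Finset.sum_const, nsmul_eq_mul, eAB]
        push_cast
        ring

theorem no_edges_product_bound
    {V : Type*} [Fintype V] [DecidableEq V] (G : SimpleGraph V) [DecidableRel G.Adj]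
    (n d : ℕ) (lam : ℝ) (hn : Fintype.card V = n) (hd : 0 < d)
    (hreg : G.IsRegularOfDegree d) (hlam : sndAbsEig G ≤ lam)
    (X Y : Finset V) (hXY : Disjoint X Y) (hnoedge : eAB G X Y = 0) :
    (X.card : ℝ) * (Y.card : ℝ) ≤
      lam ^ 2 / (d : ℝ) ^ 2 * ((n : ℝ) - (X.card : ℝ)) * ((n : ℝ) - (Y.card : ℝ)) := by
  have hX : (X.card : ℝ) ≤ n := by rw [← hn]; exact_mod_cast X.card_le_univ
  have hY : (Y.card : ℝ) ≤ n := by rw [← hn]; exact_mod_cast Y.card_le_univ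
  have hd' : (0 : ℝ) < d := Nat.cast_pos.2 hd
  have hrhs : 0 ≤ lam ^ 2 / (d : ℝ) ^ 2 * ((n : ℝ) - X.card) * ((n : ℝ) - Y.card) :=
    mul_nonneg (mul_nonneg (by positivity) (sub_nonneg.2 hX)) (sub_nonneg.2 hY)
  rcases X.eq_empty_or_nonempty with rfl | hXne
  · simpa using hrhs
  rcases Y.eq_empty_or_nonempty with rfl | hYne
  · simpa using hrhs
  have hne : Nonempty V := ⟨hXne.choose⟩
  have hXpos : (0 : ℝ) < X.card := Nat.cast_pos.2 hXne.card_pos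
  have hYpos : (0 : ℝ) < Y.card := Nat.cast_pos.2 hYne.card_pos
  have hnpos : (0 : ℝ) < n := hXpos.trans_le hX
  have hsnd : 0 ≤ sndAbsEig G := by
    unfold sndAbsEig
    generalize List.dropLast _ = l
    cases l with
    | nil => exact le_rfl
    | cons a l => exact (abs_nonneg a).trans (le_max_left _ _)
  have hsq : sndAbsEig G ^ 2 ≤ lam ^ 2 := pow_le_pow_left₀ hsnd hlam 2
  have hcs := Finset.sum_mul_sq_le_sq_mul_sq Finset.univ (centeredIndicator X)
    ((G.adjMatrix ℝ).mulVec (centeredIndicator Y))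
  have hnorm := norm_adjMatrix_mulVec_sq_le G hreg _ (sum_centeredIndicator Y)
  rw [centeredIndicator_dotProduct_adjMatrix_mulVec G hreg, hnoedge, hn,
    sum_centeredIndicator_sq, hn] at hcs
  rw [sum_centeredIndicator_sq, hn] at hnorm
  have hXn : 0 ≤ X.card * (n - X.card) / (n : ℝ) :=
    div_nonneg (mul_nonneg hXpos.le (sub_nonneg.2 hX)) hnpos.le
  have hYn : 0 ≤ Y.card * (n - Y.card) / (n : ℝ) :=
    div_nonneg (mul_nonneg hYpos.le (sub_nonneg.2 hY)) hnpos.le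
  rw [Nat.cast_zero, zero_sub, neg_sq] at hcs
  have hmain := hcs.trans (mul_le_mul_of_nonneg_left
    (hnorm.trans (mul_le_mul_of_nonneg_right hsq hYn)) hXn)
  have hfactor : 0 < (n : ℝ) ^ 2 / (d ^ 2 * X.card * Y.card) := by positivity
  calc (X.card : ℝ) * Y.card
      = (n : ℝ) ^ 2 / (d ^ 2 * X.card * Y.card) * (d * X.card * Y.card / n) ^ 2 := by
        field_simp
    _ ≤ _ := mul_le_mul_of_nonneg_left hmain hfactor.le
    _ = lam ^ 2 / (d : ℝ) ^ 2 * ((n : ℝ) - X.card) * ((n : ℝ) - Y.card) := by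
        field_simp
end

section
/- Let G be a d-regular graph on n vertices with d > 0 whose second largest absolute adjacency eigenvalue is at most λ. Suppose S, X, Y partition V(G), X and Y are nonempty, and there are no edges of G between X and Y. Then min(|X|, |Y|) ≤ (λ/d)·(|S| + min(|X|, |Y|)); in particular, |S| ≥ (d/λ − 1)·min(|X|, |Y|) when λ > 0. -/
open Finset

theorem List.le_foldr_max_of_mem {l : List ℝ} {c x : ℝ} (hx : x ∈ l) : x ≤ l.foldr max c := by
  induction l with
  | nil => simp at hx
  | cons y l ih =>
    rcases List.mem_cons.1 hx with rfl | h
    · exact le_max_left _ _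
    · exact (ih h).trans (le_max_right _ _)

theorem List.le_foldr_max (l : List ℝ) (c : ℝ) : c ≤ l.foldr max c := by
  induction l with
  | nil => exact le_rfl
  | cons y l ih => exact ih.trans (le_max_right _ _)

theorem sndAbsEig_nonneg {V : Type*} [Fintype V] [DecidableEq V] (G : SimpleGraph V)
    [DecidableRel G.Adj] : 0 ≤ sndAbsEig G :=
  List.le_foldr_max _ _

theorem Matrix.IsHermitian.dotProduct_eigenvectorBasis_mulVec {V : Type*} [Fintype V]
    [DecidableEq V] {A : Matrix V V ℝ} (hA : A.IsHermitian) (i : V) (v : V → ℝ) :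
    (hA.eigenvectorBasis i).ofLp ⬝ᵥ A.mulVec v
      = hA.eigenvalues i * ((hA.eigenvectorBasis i).ofLp ⬝ᵥ v) := by
  have hT : A.transpose = A := by
    rw [← Matrix.conjTranspose_eq_transpose_of_trivial]; exact hA
  rw [Matrix.dotProduct_mulVec, ← Matrix.mulVec_transpose, hT, hA.mulVec_eigenvectorBasis,
    smul_dotProduct, smul_eq_mul]

theorem OrthonormalBasis.sum_dotProduct_mul_dotProduct {V : Type*} [Fintype V]
    (b : OrthonormalBasis V ℝ (EuclideanSpace ℝ V)) (u v : V → ℝ) :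
    ∑ i, ((b i).ofLp ⬝ᵥ u) * ((b i).ofLp ⬝ᵥ v) = u ⬝ᵥ v := by
  have h := b.sum_inner_mul_inner (WithLp.toLp 2 u) (WithLp.toLp 2 v)
  simp only [EuclideanSpace.inner_eq_star_dotProduct, star_trivial] at h
  rw [dotProduct_comm u v, ← h]
  exact Finset.sum_congr rfl fun i _ => by rw [dotProduct_comm v]

theorem SimpleGraph.IsRegularOfDegree.adjMatrix_mulVec_one {V : Type*} [Fintype V]
    {G : SimpleGraph V} [DecidableRel G.Adj] {d : ℕ} (hreg : G.IsRegularOfDegree d) :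
    (G.adjMatrix ℝ).mulVec 1 = (d : ℝ) • (1 : V → ℝ) := by
  ext x
  have h := SimpleGraph.adjMatrix_mulVec_const_apply_of_regular (α := ℝ) (a := 1) hreg (v := x)
  rw [mul_one] at h
  rw [Pi.smul_apply, Pi.one_apply, smul_eq_mul, mul_one]
  exact h

/-- For a `d`-regular graph with `sndAbsEig G < d`, the adjacency form is bounded by
`sndAbsEig G` as soon as one argument is orthogonal to the constant vector. -/
theorem sq_dotProduct_adjMatrix_mulVec_le {V : Type*} [Fintype V] [DecidableEq V] [Nonempty V]
    (G : SimpleGraph V) [DecidableRel G.Adj] {d : ℕ} (hreg : G.IsRegularOfDegree d)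
    (hlt : sndAbsEig G < d) (u v : V → ℝ) (hu : u ⬝ᵥ 1 = 0) :
    (u ⬝ᵥ (G.adjMatrix ℝ).mulVec v) ^ 2 ≤ sndAbsEig G ^ 2 * ((u ⬝ᵥ u) * (v ⬝ᵥ v)) := by
  obtain ⟨i₀, hi₀⟩ := exists_forall_ne_abs_eigenvalues_le_sndAbsEig G
  set hA := adjMatrix_isHermitian G
  set b := hA.eigenvectorBasis
  have hone := hreg.adjMatrix_mulVec_one
  have hperp : ∀ i, i ≠ i₀ → (b i).ofLp ⬝ᵥ 1 = 0 := by
    intro i hi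
    have h := hA.dotProduct_eigenvectorBasis_mulVec i 1
    rw [hone, dotProduct_smul, smul_eq_mul] at h
    have hne : (d : ℝ) - hA.eigenvalues i ≠ 0 := by
      have := (le_abs_self _).trans (hi₀ i hi)
      linarith
    exact (mul_eq_zero.1 (by linear_combination h :
      ((d : ℝ) - hA.eigenvalues i) * ((b i).ofLp ⬝ᵥ 1) = 0)).resolve_left hne
  have hexpand : ∀ w : V → ℝ, ((b i₀).ofLp ⬝ᵥ w) * ((b i₀).ofLp ⬝ᵥ 1) = w ⬝ᵥ 1 := by
    intro w
    rw [← b.sum_dotProduct_mul_dotProduct w 1]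
    symm
    refine Finset.sum_eq_single i₀ (fun i _ hi => ?_) (by simp)
    rw [hperp i hi, mul_zero]
  have hb : (b i₀).ofLp ⬝ᵥ 1 ≠ 0 := by
    intro h
    have := hexpand 1
    simp [h, eq_comm] at this
  have hu₀ : (b i₀).ofLp ⬝ᵥ u = 0 :=
    (mul_eq_zero.1 ((hexpand u).trans hu)).resolve_right hb
  have hbound : ∀ i, (hA.eigenvalues i * ((b i).ofLp ⬝ᵥ u)) ^ 2
      ≤ sndAbsEig G ^ 2 * (((b i).ofLp ⬝ᵥ u) * ((b i).ofLp ⬝ᵥ u)) := by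
    intro i
    by_cases hi : i = i₀
    · simp [hi, hu₀]
    · rw [mul_pow, ← sq]
      exact mul_le_mul_of_nonneg_right
        (sq_le_sq.2 ((hi₀ i hi).trans (le_abs_self _))) (sq_nonneg _)
  calc (u ⬝ᵥ (G.adjMatrix ℝ).mulVec v) ^ 2
      = (∑ i, (hA.eigenvalues i * ((b i).ofLp ⬝ᵥ u)) * ((b i).ofLp ⬝ᵥ v)) ^ 2 := by
        rw [← b.sum_dotProduct_mul_dotProduct]
        congr 1
        refine Finset.sum_congr rfl fun i _ => ?_
        rw [hA.dotProduct_eigenvectorBasis_mulVec]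
        ring
    _ ≤ (∑ i, (hA.eigenvalues i * ((b i).ofLp ⬝ᵥ u)) ^ 2) *
          (∑ i, ((b i).ofLp ⬝ᵥ v) ^ 2) :=
        Finset.sum_mul_sq_le_sq_mul_sq _ _ _
    _ ≤ (sndAbsEig G ^ 2 * (u ⬝ᵥ u)) * (v ⬝ᵥ v) := by
        rw [← b.sum_dotProduct_mul_dotProduct u u, ← b.sum_dotProduct_mul_dotProduct v v,
          Finset.mul_sum Finset.univ _ (sndAbsEig G ^ 2)]
        simp only [← sq (_ ⬝ᵥ v)]
        exact mul_le_mul_of_nonneg_right (Finset.sum_le_sum fun i _ => hbound i)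
          (Finset.sum_nonneg fun i _ => sq_nonneg _)
    _ = sndAbsEig G ^ 2 * ((u ⬝ᵥ u) * (v ⬝ᵥ v)) := mul_assoc _ _ _

/-- Expander mixing for two disjoint, mutually non-adjacent vertex sets. -/
theorem sq_mul_card_mul_card_le {V : Type*} [Fintype V] [DecidableEq V]
    (G : SimpleGraph V) [DecidableRel G.Adj] {d : ℕ} (hreg : G.IsRegularOfDegree d)
    (hlt : sndAbsEig G < d) {X Y : Finset V} (hX : X.Nonempty) (hY : Y.Nonempty)
    (hnoedge : ∀ x ∈ X, ∀ y ∈ Y, ¬ G.Adj x y) :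
    (d : ℝ) ^ 2 * (X.card * Y.card) ≤ sndAbsEig G ^ 2 *
      ((Fintype.card V - X.card) * (Fintype.card V - Y.card)) := by
  have : Nonempty V := ⟨hX.choose⟩
  set n : ℝ := (Fintype.card V : ℝ) with hn
  set f : V → ℝ := fun z => if z ∈ X then 1 else 0 with hf
  set g : V → ℝ := fun z => if z ∈ Y then 1 else 0 with hg
  set A := G.adjMatrix ℝ with hAdef
  have hnpos : 0 < n := by simp [hn, Fintype.card_pos]
  have hxpos : (0 : ℝ) < X.card := by exact_mod_cast hX.card_pos
  have hypos : (0 : ℝ) < Y.card := by exact_mod_cast hY.card_pos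
  have h11 : (1 : V → ℝ) ⬝ᵥ 1 = n := by simp [hn]
  have hf1 : f ⬝ᵥ 1 = X.card := by simp [hf, dotProduct]
  have hff : f ⬝ᵥ f = X.card := by simp [hf, dotProduct]
  have hg1 : g ⬝ᵥ 1 = Y.card := by simp [hg, dotProduct]
  have hgg : g ⬝ᵥ g = Y.card := by simp [hg, dotProduct]
  have h1f : 1 ⬝ᵥ f = X.card := by rw [dotProduct_comm, hf1]
  have h1g : 1 ⬝ᵥ g = Y.card := by rw [dotProduct_comm, hg1]
  have hA1 : A.mulVec 1 = (d : ℝ) • (1 : V → ℝ) := hreg.adjMatrix_mulVec_one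
  have h1A : ∀ w, 1 ⬝ᵥ A.mulVec w = d * (1 ⬝ᵥ w) := by
    intro w
    rw [Matrix.dotProduct_mulVec, ← Matrix.mulVec_transpose, hAdef,
      SimpleGraph.transpose_adjMatrix, ← hAdef, hA1, smul_dotProduct, smul_eq_mul]
  have hfg : f ⬝ᵥ A.mulVec g = 0 := by
    simp only [dotProduct, Matrix.mulVec]
    refine Finset.sum_eq_zero fun x _ => ?_
    by_cases hx : x ∈ X
    · refine mul_eq_zero_of_right _ (Finset.sum_eq_zero fun y _ => ?_)
      by_cases hy : y ∈ Y
      · simp [hAdef, SimpleGraph.adjMatrix_apply, hnoedge x hx y hy]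
      · simp [hg, hy]
    · simp [hf, hx]
  have key := sq_dotProduct_adjMatrix_mulVec_le G hreg hlt (n • f - (X.card : ℝ) • 1)
    (n • g - (Y.card : ℝ) • 1) (by
      simp only [sub_dotProduct, smul_dotProduct, smul_eq_mul, hf1, h11]; ring)
  rw [← hAdef] at key
  simp only [Matrix.mulVec_sub, Matrix.mulVec_smul, hA1, sub_dotProduct, dotProduct_sub,
    smul_dotProduct, dotProduct_smul, smul_eq_mul, h1A, hfg, hf1, hff, hg1, hgg, h1f, h1g,
    h11] at key
  refine le_of_mul_le_mul_left ?_
    (mul_pos (mul_pos hnpos hnpos) (mul_pos hxpos hypos))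
  linear_combination key

theorem partition_separator_bound
    {V : Type*} [Fintype V] [DecidableEq V] (G : SimpleGraph V) [DecidableRel G.Adj]
    (n d : ℕ) (lam : ℝ) (hn : Fintype.card V = n) (hd : 0 < d)
    (hreg : G.IsRegularOfDegree d) (hlam : sndAbsEig G ≤ lam)
    (S X Y : Finset V) (hSX : Disjoint S X) (hSY : Disjoint S Y) (hXY : Disjoint X Y)
    (hcover : S ∪ X ∪ Y = Finset.univ)
    (hX : X.Nonempty) (hY : Y.Nonempty)
    (hnoedge : ∀ x ∈ X, ∀ y ∈ Y, ¬ G.Adj x y) :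
    ((min X.card Y.card : ℕ) : ℝ) ≤
        lam / (d : ℝ) * ((S.card : ℝ) + ((min X.card Y.card : ℕ) : ℝ)) ∧
      (0 < lam →
        ((d : ℝ) / lam - 1) * ((min X.card Y.card : ℕ) : ℝ) ≤ (S.card : ℝ)) := by
  have hd' : (0 : ℝ) < d := by exact_mod_cast hd
  have hlam0 : 0 ≤ lam := (sndAbsEig_nonneg G).trans hlam
  set m : ℝ := ((min X.card Y.card : ℕ) : ℝ) with hm
  have hm0 : 0 ≤ m := Nat.cast_nonneg _
  have hs0 : (0 : ℝ) ≤ S.card := Nat.cast_nonneg _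
  have hmX : m ≤ X.card := by rw [hm]; exact_mod_cast min_le_left _ _
  have hmY : m ≤ Y.card := by rw [hm]; exact_mod_cast min_le_right _ _
  have hcard : (Fintype.card V : ℝ) = S.card + X.card + Y.card := by
    rw [← Finset.card_univ, ← hcover, Finset.card_union_of_disjoint
      (Finset.disjoint_union_left.2 ⟨hSY, hXY⟩), Finset.card_union_of_disjoint hSX]
    push_cast
    ring
  have main : d * m ≤ lam * (S.card + m) := by
    by_contra! hcon
    have hlt : lam < d := by
      by_contra! hle
      have h₁ := mul_le_mul_of_nonneg_right hle hm0
      have h₂ := mul_nonneg hlam0 hs0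
      linarith
    have hmix := sq_mul_card_mul_card_le G hreg (hlam.trans_lt hlt) hX hY hnoedge
    rw [hcard] at hmix
    have hstrict : ∀ {t : ℝ}, m ≤ t → lam * (S.card + t) < d * t := by
      intro t ht
      have := mul_le_mul_of_nonneg_left ht (sub_nonneg.2 hlt.le)
      linarith
    have hprod := mul_lt_mul'' (hstrict hmX) (hstrict hmY) (by positivity) (by positivity)
    have hsq : sndAbsEig G ^ 2 ≤ lam ^ 2 := pow_le_pow_left₀ (sndAbsEig_nonneg G) hlam 2
    have hnn : (0 : ℝ) ≤ (S.card + Y.card) * (S.card + X.card) := by positivity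
    have := mul_le_mul_of_nonneg_right hsq hnn
    linarith
  refine ⟨?_, fun hpos => ?_⟩
  · rw [div_mul_eq_mul_div, le_div_iff₀ hd']
    linarith
  · have : (d : ℝ) / lam * m ≤ S.card + m := by
      rw [div_mul_eq_mul_div, div_le_iff₀ hpos]
      linarith
    linarith
end
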